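/- Let A, B, R be three independent points uniformly distributed on the unit square [0,1]² ⊂ ℝ², and let θ be independent and uniformly distributed on [0, 2π). Then the probability that the ray from R in direction (cos θ, sin θ) intersects the closed segment from A to B equals 1/6. -/

import Mathlib

open Real Set MeasureTheory

/-- The unit square `[0,1]²` in the Euclidean plane. -/
def unitSquare : Set (EuclideanSpace ℝ (Fin 2)) :=
  {p | p 0 ∈ Set.Icc (0 : ℝ) 1 ∧ p 1 ∈ Set.Icc (0 : ℝ) 1}

/-- The uniform (Lebesgue) probability measure on the unit square `[0,1]²`. -/
noncomputable def unifSquare : Measure (EuclideanSpace ℝ (Fin 2)) :=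
  volume.restrict unitSquare

/-- The uniform probability measure on the interval of angles `[0, 2π)`. -/
noncomputable def unifAngle : Measure ℝ :=
  (ENNReal.ofReal (2 * π))⁻¹ • volume.restrict (Set.Ico 0 (2 * π))

/-- The direction vector of angle `θ` in the Euclidean plane. -/
noncomputable def dirVec (θ : ℝ) : EuclideanSpace ℝ (Fin 2) :=
  (WithLp.equiv 2 (Fin 2 → ℝ)).symm ![Real.cos θ, Real.sin θ]

/-- The Euclidean plane. -/
abbrev Plane := EuclideanSpace ℝ (Fin 2)

/-- The law of the triple of points together with the angle. -/
noncomputable def configLaw : Measure (Plane × Plane × Plane × ℝ) :=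
  unifSquare.prod (unifSquare.prod (unifSquare.prod unifAngle))

/-- The two-dimensional cross product. -/
def cross (u v : Plane) : ℝ := u 0 * v 1 - u 1 * v 0

/-- The configurations in which the ray from `R` in direction `θ` meets the segment `[A, B]`. -/
def rayEvent : Set (Plane × Plane × Plane × ℝ) :=
  {x | ∃ t : ℝ, 0 ≤ t ∧ ∃ s ∈ Set.Icc (0 : ℝ) 1,
    x.2.2.1 + t • dirVec x.2.2.2 = x.1 + s • (x.2.1 - x.1)}

/-- The configurations in which the ray from `R` in the direction opposite to `θ` meets the
segment `[A, B]`. -/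
def oppositeRayEvent : Set (Plane × Plane × Plane × ℝ) :=
  {x | ∃ t : ℝ, 0 ≤ t ∧ ∃ s ∈ Set.Icc (0 : ℝ) 1,
    x.2.2.1 - t • dirVec x.2.2.2 = x.1 + s • (x.2.1 - x.1)}

/-- The configurations in which the line through `R` with direction `θ` weakly separates
`A` and `B`. -/
def lineEvent : Set (Plane × Plane × Plane × ℝ) :=
  {x | cross (dirVec x.2.2.2) (x.1 - x.2.2.1) * cross (dirVec x.2.2.2) (x.2.1 - x.2.2.1) ≤ 0}

/-- The configurations in which `B` and `R` lie on a common line with direction `θ`. -/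
def alignedEvent : Set (Plane × Plane × Plane × ℝ) :=
  {x | cross (dirVec x.2.2.2) (x.2.1 - x.2.2.1) = 0}

/-- The reflection of the plane in the centre of the unit square. -/
noncomputable def reflectPoint (p : Plane) : Plane := !₂[1, 1] - p

/-- The reflection of all three points in the centre of the unit square. -/
noncomputable def reflectConfig (x : Plane × Plane × Plane × ℝ) : Plane × Plane × Plane × ℝ :=
  (reflectPoint x.1, reflectPoint x.2.1, reflectPoint x.2.2.1, x.2.2.2)

/-- Exchange of the first two entries of a triple. -/
def swapFirst {α β : Type*} (x : α × α × β) : α × α × β := (x.2.1, x.1, x.2.2)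

/-- Exchange of the points `B` and `R`. -/
def swapLast (x : Plane × Plane × Plane × ℝ) : Plane × Plane × Plane × ℝ := (x.1, swapFirst x.2)

@[simp] lemma dirVec_zero (θ : ℝ) : dirVec θ 0 = Real.cos θ := rfl

@[simp] lemma dirVec_one (θ : ℝ) : dirVec θ 1 = Real.sin θ := rfl

lemma continuous_dirVec : Continuous dirVec := by
  unfold dirVec
  refine (PiLp.continuous_toLp 2 _).comp (continuous_pi fun i => ?_)
  fin_cases i
  · exact Real.continuous_cos
  · exact Real.continuous_sin

lemma continuous_cross {X : Type*} [TopologicalSpace X] {f g : X → Plane}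
    (hf : Continuous f) (hg : Continuous g) : Continuous fun x => cross (f x) (g x) := by
  unfold cross
  fun_prop

lemma norm_dirVec (θ : ℝ) : ‖dirVec θ‖ = 1 := by
  simp [EuclideanSpace.norm_eq, Fin.sum_univ_two]

instance : IsProbabilityMeasure unifSquare := by
  constructor
  have hv := EuclideanSpace.volume_preserving_symm_measurableEquiv_toLp (Fin 2)
  have h : unitSquare = (MeasurableEquiv.toLp 2 (Fin 2 → ℝ)).symm ⁻¹' Set.Icc 0 1 := by
    ext p
    simp [unitSquare, Pi.le_def, Fin.forall_fin_two]
    tauto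
  rw [unifSquare, Measure.restrict_apply_univ, h, hv.measure_preimage_equiv, Real.volume_Icc_pi]
  simp

instance : IsProbabilityMeasure unifAngle := by
  constructor
  have h : (0 : ℝ) < 2 * π := by positivity
  simp only [unifAngle, Measure.smul_apply, Measure.restrict_apply_univ, Real.volume_Ico, sub_zero,
    smul_eq_mul]
  exact ENNReal.inv_mul_cancel (by simpa using h) ENNReal.ofReal_ne_top

instance : IsProbabilityMeasure configLaw := by
  unfold configLaw
  infer_instance

lemma measurePreserving_reflectPoint : MeasurePreserving reflectPoint unifSquare unifSquare := by
  have h : MeasurePreserving reflectPoint volume volume :=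
    Measure.measurePreserving_sub_left volume _
  have hs : MeasurableSet unitSquare := by
    apply IsClosed.measurableSet
    apply IsClosed.inter
    · exact isClosed_Icc.preimage (by fun_prop : Continuous fun p : Plane => p 0)
    · exact isClosed_Icc.preimage (by fun_prop : Continuous fun p : Plane => p 1)
  have hr := h.restrict_preimage hs
  have he : reflectPoint ⁻¹' unitSquare = unitSquare := by
    ext p
    simp [reflectPoint, unitSquare]
    tauto
  rwa [he] at hr

lemma measurePreserving_reflectConfig : MeasurePreserving reflectConfig configLaw configLaw :=
  measurePreserving_reflectPoint.prod (measurePreserving_reflectPoint.prod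
    (measurePreserving_reflectPoint.prod (MeasurePreserving.id _)))

lemma measurePreserving_swapFirst {α β : Type*} [MeasurableSpace α] [MeasurableSpace β]
    (μ : Measure α) (ν : Measure β) [SFinite μ] [SFinite ν] :
    MeasurePreserving swapFirst (μ.prod (μ.prod ν)) (μ.prod (μ.prod ν)) :=
  (measurePreserving_prodAssoc μ μ ν).comp
    (((Measure.measurePreserving_swap (μ := μ) (ν := μ)).prod (MeasurePreserving.id ν)).comp
      (measurePreserving_prodAssoc μ μ ν).symm)

lemma measurePreserving_swapLast : MeasurePreserving swapLast configLaw configLaw :=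
  (MeasurePreserving.id _).prod (measurePreserving_swapFirst _ _)

lemma isClosed_rayEvent : IsClosed rayEvent := by
  let C : Set (unitInterval × Plane × Plane × Plane × ℝ) :=
    {y | y.2.2.2.1 + ‖y.2.1 + (y.1 : ℝ) • (y.2.2.1 - y.2.1) - y.2.2.2.1‖ • dirVec y.2.2.2.2 =
      y.2.1 + (y.1 : ℝ) • (y.2.2.1 - y.2.1)}
  have hC : IsClosed C := by
    have := continuous_dirVec
    exact isClosed_eq (by fun_prop) (by fun_prop)
  have h : rayEvent = Prod.snd '' C := by
    ext x
    constructor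
    · rintro ⟨t, ht, s, hs, h⟩
      refine ⟨(⟨s, hs⟩, x), ?_, rfl⟩
      simp [C, ← h, norm_smul, norm_dirVec, abs_of_nonneg ht]
    · rintro ⟨⟨s, y⟩, hy, rfl⟩
      exact ⟨_, norm_nonneg _, s, s.2, hy⟩
  rw [h]
  exact isClosedMap_snd_of_compactSpace _ hC

lemma measurableSet_lineEvent : MeasurableSet lineEvent := by
  have := continuous_dirVec
  exact (isClosed_le ((continuous_cross (by fun_prop) (by fun_prop)).mul
    (continuous_cross (by fun_prop) (by fun_prop))) continuous_const).measurableSet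

lemma measurableSet_alignedEvent : MeasurableSet alignedEvent := by
  have := continuous_dirVec
  exact (isClosed_eq (continuous_cross (by fun_prop) (by fun_prop)) continuous_const).measurableSet

lemma unifSquare_line (u q : Plane) (hu : u ≠ 0) : unifSquare {p | cross u (q - p) = 0} = 0 := by
  let f : Plane →ₗ[ℝ] ℝ :=
    { toFun := cross u
      map_add' := fun x y => by simp [cross]; ring
      map_smul' := fun c x => by simp [cross]; ring }
  have hne : AffineSubspace.mk' q f.ker ≠ ⊤ := by
    intro h
    have hd := congrArg AffineSubspace.direction h
    rw [AffineSubspace.direction_mk', AffineSubspace.direction_top, LinearMap.ker_eq_top] at hd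
    apply hu
    have h0 : f !₂[1, 0] = 0 := by rw [hd]; rfl
    have h1 : f !₂[0, 1] = 0 := by rw [hd]; rfl
    simp [f, cross] at h0 h1
    ext i
    fin_cases i <;> simp [h0, h1]
  refine le_antisymm ((Measure.restrict_apply_le _ _).trans ?_) bot_le
  rw [← Measure.addHaar_affineSubspace volume _ hne]
  refine measure_mono fun p hp => ?_
  simp only [SetLike.mem_coe, AffineSubspace.mem_mk', LinearMap.mem_ker, vsub_eq_sub]
  rw [← neg_sub, map_neg, neg_eq_zero]
  exact hp

lemma configLaw_eq_zero_of_sections {N : Set (Plane × Plane × Plane × ℝ)} (hN : MeasurableSet N)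
    (h : ∀ A B θ, unifSquare {R | (A, B, R, θ) ∈ N} = 0) : configLaw N = 0 := by
  rw [configLaw, Measure.measure_prod_null hN]
  refine .of_forall fun A => ?_
  have hA : MeasurableSet (Prod.mk A ⁻¹' N) := measurable_prodMk_left hN
  refine (Measure.measure_prod_null hA).2 (.of_forall fun B => ?_)
  have hB : MeasurableSet (Prod.mk B ⁻¹' (Prod.mk A ⁻¹' N)) := measurable_prodMk_left hA
  simp only [Pi.zero_apply]
  rw [Measure.prod_apply_symm hB]
  exact (lintegral_congr fun θ => h A B θ).trans lintegral_zero

lemma dirVec_ne_zero (θ : ℝ) : dirVec θ ≠ 0 := by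
  rw [← norm_ne_zero_iff, norm_dirVec]
  exact one_ne_zero

lemma configLaw_alignedEvent : configLaw alignedEvent = 0 :=
  configLaw_eq_zero_of_sections measurableSet_alignedEvent fun _ B θ =>
    unifSquare_line (dirVec θ) B (dirVec_ne_zero θ)

lemma configLaw_preimage_alignedEvent :
    configLaw (swapFirst ⁻¹' alignedEvent) = 0 ∧
      configLaw (swapLast ⁻¹' (swapFirst ⁻¹' alignedEvent)) = 0 := by
  have hm : MeasurePreserving swapFirst configLaw configLaw := measurePreserving_swapFirst _ _
  have h1 : configLaw (swapFirst ⁻¹' alignedEvent) = 0 :=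
    (hm.measure_preimage
      measurableSet_alignedEvent.nullMeasurableSet).trans configLaw_alignedEvent
  exact ⟨h1, (measurePreserving_swapLast.measure_preimage
    (hm.measurable measurableSet_alignedEvent).nullMeasurableSet).trans h1⟩

lemma cross_sub (u v w : Plane) : cross u (v - w) = cross u v - cross u w := by
  simp [cross]; ring

lemma configLaw_lineEvent : 3 * configLaw lineEvent = 1 := by
  set L := lineEvent with hL
  set M := swapLast ⁻¹' L with hM
  set N := swapFirst ⁻¹' M with hN
  have mL : MeasurableSet L := measurableSet_lineEvent
  have mM : MeasurableSet M := measurePreserving_swapLast.measurable mL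
  have mN : MeasurableSet N :=
    (measurePreserving_swapFirst unifSquare (unifSquare.prod unifAngle)).measurable mM
  have pM : configLaw M = configLaw L :=
    measurePreserving_swapLast.measure_preimage mL.nullMeasurableSet
  have pN : configLaw N = configLaw M :=
    (measurePreserving_swapFirst _ _).measure_preimage mM.nullMeasurableSet
  have hU : L ∪ M ∪ N = univ := by
    ext ⟨A, B, R, θ⟩
    simp only [hN, hM, hL, lineEvent, swapLast, swapFirst, mem_union, mem_preimage, mem_ofPred_eq,
      mem_univ, iff_true, cross_sub]
    generalize cross (dirVec θ) A = a
    generalize cross (dirVec θ) B = b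
    generalize cross (dirVec θ) R = r
    by_contra! h
    obtain ⟨⟨h1, h2⟩, h3⟩ := h
    rcases le_total a b with hab | hab <;> rcases le_total b r with hbr | hbr <;>
      rcases le_total a r with har | har <;> nlinarith
  obtain ⟨z1, z2⟩ := configLaw_preimage_alignedEvent
  have hdisj : configLaw ((L ∩ M) ∪ ((L ∪ M) ∩ N)) = 0 := by
    refine measure_mono_null ?_ (measure_union_null (measure_union_null configLaw_alignedEvent z1) z2)
    rintro ⟨A, B, R, θ⟩
    simp only [hN, hM, hL, lineEvent, alignedEvent, swapLast, swapFirst, mem_union, mem_inter_iff,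
      mem_preimage, mem_ofPred_eq, cross_sub, sub_eq_zero]
    generalize cross (dirVec θ) A = a
    generalize cross (dirVec θ) B = b
    generalize cross (dirVec θ) R = r
    intro h
    by_contra! h'
    obtain ⟨⟨hbr, har⟩, hab⟩ := h'
    rcases lt_or_gt_of_ne hbr with hbr | hbr <;> rcases lt_or_gt_of_ne har with har | har <;>
      rcases lt_or_gt_of_ne hab with hab | hab <;>
      rcases h with ⟨h1, h2⟩ | ⟨h1 | h1, h2⟩ <;> nlinarith
  have d1 : configLaw (L ∩ M) = 0 := measure_mono_null subset_union_left hdisj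
  have d2 : configLaw ((L ∪ M) ∩ N) = 0 := measure_mono_null subset_union_right hdisj
  have e1 := measure_union_add_inter (μ := configLaw) L mM
  have e2 := measure_union_add_inter (μ := configLaw) (L ∪ M) mN
  rw [hU, measure_univ, d2, add_zero] at e2
  rw [d1, add_zero] at e1
  rw [e2, e1, pN, pM]
  ring

lemma reflectConfig_preimage_rayEvent : reflectConfig ⁻¹' rayEvent = oppositeRayEvent := by
  ext ⟨A, B, R, θ⟩
  simp only [rayEvent, oppositeRayEvent, reflectConfig, reflectPoint, mem_preimage, mem_ofPred_eq]
  refine exists_congr fun t => and_congr_right fun _ => exists_congr fun s =>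
    and_congr_right fun _ => ?_
  rw [← sub_eq_zero, ← neg_eq_zero, ← sub_eq_zero (a := R - t • dirVec θ)]
  refine Eq.congr_left ?_
  module

lemma configLaw_rayEvent_inter : configLaw (rayEvent ∩ oppositeRayEvent) = 0 := by
  let N : Set (Plane × Plane × Plane × ℝ) :=
    {x | cross (x.2.1 - x.1) (x.1 - x.2.2.1) = 0 ∧ x.2.1 - x.1 ≠ 0}
  have mN : MeasurableSet N := by
    refine (isClosed_eq (continuous_cross (by fun_prop) (by fun_prop))
      continuous_const).measurableSet.inter ?_
    exact (isOpen_ne_fun (by fun_prop) (by fun_prop)).measurableSet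
  have hN : configLaw N = 0 := by
    refine configLaw_eq_zero_of_sections mN fun A B θ => ?_
    by_cases h : B - A = 0
    · simp [N, h]
    · exact measure_mono_null (fun R hR => hR.1) (unifSquare_line (B - A) A h)
  refine measure_mono_null ?_ (measure_union_null hN configLaw_preimage_alignedEvent.2)
  rintro ⟨A, B, R, θ⟩ ⟨⟨t, ht, s, -, h⟩, ⟨t', ht', s', -, h'⟩⟩
  simp only [alignedEvent, swapLast, swapFirst, mem_union, mem_preimage, mem_ofPred_eq, N] at h h' ⊢
  by_contra! hc
  obtain ⟨hc, hab⟩ := hc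
  have key : (s - s') * cross (dirVec θ) (A - B) = 0 := by
    have h0 := congrArg (· 0) h
    have h1 := congrArg (· 1) h
    have h0' := congrArg (· 0) h'
    have h1' := congrArg (· 1) h'
    simp at h0 h1 h0' h1'
    simp only [cross, dirVec_zero, dirVec_one, PiLp.sub_apply]
    linear_combination (Real.cos θ) * (h1 - h1') - Real.sin θ * (h0 - h0')
  have hs : s = s' := by
    rcases mul_eq_zero.1 key with hk | hk
    · linarith
    · exact absurd hk hab
  subst hs
  have htt : (t + t') • dirVec θ = 0 := by
    have : (t + t') • dirVec θ = (R + t • dirVec θ) - (R - t' • dirVec θ) := by module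
    rw [this, h, h', sub_self]
  have ht0 : t = 0 := by
    have := (smul_eq_zero.1 htt).resolve_right (dirVec_ne_zero θ)
    linarith
  rw [ht0, zero_smul, add_zero] at h
  have hBA : B - A = 0 := by
    apply hc
    rw [h]
    simp [cross]
    ring
  apply hab
  rw [← neg_sub, hBA]
  simp [cross]

lemma rayEvent_union_subset : rayEvent ∪ oppositeRayEvent ⊆ lineEvent := by
  have key : ∀ (A B R : Plane) (θ t s : ℝ), s ∈ Set.Icc (0 : ℝ) 1 →
      R + t • dirVec θ = A + s • (B - A) → (A, B, R, θ) ∈ lineEvent := by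
    intro A B R θ t s ⟨hs0, hs1⟩ h
    have hr : cross (dirVec θ) R =
        cross (dirVec θ) A + s * (cross (dirVec θ) B - cross (dirVec θ) A) := by
      have h0 := congrArg (· 0) h
      have h1 := congrArg (· 1) h
      simp [cross] at h0 h1 ⊢
      linear_combination (Real.cos θ) * h1 - Real.sin θ * h0
    simp only [lineEvent, mem_ofPred_eq, cross_sub, hr]
    nlinarith [mul_nonneg (mul_nonneg hs0 (sub_nonneg.2 hs1))
      (sq_nonneg (cross (dirVec θ) B - cross (dirVec θ) A))]
  rintro ⟨A, B, R, θ⟩ (⟨t, -, s, hs, h⟩ | ⟨t, -, s, hs, h⟩)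
  · exact key A B R θ t s hs h
  · exact key A B R θ (-t) s hs (by rw [neg_smul, ← sub_eq_add_neg]; exact h)

lemma lineEvent_subset :
    lineEvent ⊆ (rayEvent ∪ oppositeRayEvent) ∪ swapLast ⁻¹' (swapFirst ⁻¹' alignedEvent) := by
  rintro ⟨A, B, R, θ⟩ h
  simp only [lineEvent, alignedEvent, swapLast, swapFirst, mem_union, mem_preimage, mem_ofPred_eq,
    cross_sub, sub_eq_zero] at h ⊢
  by_cases hab : cross (dirVec θ) A = cross (dirVec θ) B
  · exact Or.inr hab
  left
  obtain ⟨s, hs, hr⟩ : ∃ s ∈ Set.Icc (0 : ℝ) 1, cross (dirVec θ) R =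
      cross (dirVec θ) A + s * (cross (dirVec θ) B - cross (dirVec θ) A) := by
    generalize cross (dirVec θ) A = a at *
    generalize cross (dirVec θ) B = b at *
    generalize cross (dirVec θ) R = r at *
    have hba : b - a ≠ 0 := sub_ne_zero.2 (Ne.symm hab)
    refine ⟨(r - a) / (b - a), ?_, by field_simp; ring⟩
    rcases lt_or_gt_of_ne hba with hlt | hlt
    · refine ⟨div_nonneg_of_nonpos (by nlinarith) hlt.le, ?_⟩
      rw [div_le_one_of_neg hlt]
      nlinarith
    · refine ⟨div_nonneg (by nlinarith) hlt.le, ?_⟩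
      rw [div_le_one hlt]
      nlinarith
  obtain ⟨t, ht⟩ : ∃ t : ℝ, R + t • dirVec θ = A + s • (B - A) := by
    refine ⟨Real.cos θ * (A 0 + s * (B 0 - A 0) - R 0) +
      Real.sin θ * (A 1 + s * (B 1 - A 1) - R 1), ?_⟩
    have hcs := Real.sin_sq_add_cos_sq θ
    simp only [cross, dirVec_zero, dirVec_one] at hr
    ext i
    fin_cases i
    · simp
      linear_combination (A 0 + s * (B 0 - A 0) - R 0) * hcs - Real.sin θ * hr
    · simp
      linear_combination (A 1 + s * (B 1 - A 1) - R 1) * hcs + Real.cos θ * hr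
  rcases le_total 0 t with h0 | h0
  · exact Or.inl ⟨t, h0, s, hs, ht⟩
  · refine Or.inr ⟨-t, neg_nonneg.2 h0, s, hs, ?_⟩
    rw [neg_smul, sub_neg_eq_add]
    exact ht

lemma two_mul_configLaw_rayEvent : 2 * configLaw rayEvent = configLaw lineEvent := by
  have mE : MeasurableSet rayEvent := isClosed_rayEvent.measurableSet
  have mE' : MeasurableSet oppositeRayEvent := by
    rw [← reflectConfig_preimage_rayEvent]
    exact measurePreserving_reflectConfig.measurable mE
  have hE' : configLaw oppositeRayEvent = configLaw rayEvent := by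
    rw [← reflectConfig_preimage_rayEvent]
    exact measurePreserving_reflectConfig.measure_preimage mE.nullMeasurableSet
  have hU : configLaw lineEvent = configLaw (rayEvent ∪ oppositeRayEvent) := by
    refine le_antisymm ((measure_mono lineEvent_subset).trans ?_)
      (measure_mono rayEvent_union_subset)
    refine (measure_union_le _ _).trans ?_
    rw [configLaw_preimage_alignedEvent.2, add_zero]
  have h := measure_union_add_inter (μ := configLaw) rayEvent mE'
  rw [configLaw_rayEvent_inter, add_zero, hE', ← hU] at h
  rw [h, two_mul]

/-- For `A`, `B`, `R` independent uniform random points on the unit square and `θ`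
an independent uniform random angle in `[0, 2π)`, the probability that the ray from
`R` in direction `(cos θ, sin θ)` intersects the closed segment `[A, B]` is `1/6`. -/
theorem stmt_4 :
    (unifSquare.prod (unifSquare.prod (unifSquare.prod unifAngle)))
      {x : EuclideanSpace ℝ (Fin 2) ×
            EuclideanSpace ℝ (Fin 2) × EuclideanSpace ℝ (Fin 2) × ℝ |
        ∃ t : ℝ, 0 ≤ t ∧ ∃ s ∈ Set.Icc (0 : ℝ) 1,
          x.2.2.1 + t • dirVec x.2.2.2 = x.1 + s • (x.2.1 - x.1)}
      = 1 / 6 := by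
  change configLaw rayEvent = 1 / 6
  have h : 6 * configLaw rayEvent = 1 := by
    rw [← configLaw_lineEvent, ← two_mul_configLaw_rayEvent, ← mul_assoc]
    norm_num
  rw [ENNReal.eq_div_iff (by norm_num) (by norm_num), h]
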